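/- The sets Ξ_λ for λ ∈ 𝔫* partition 𝔫*; the sets of irreducible constituents Irr(G, ξ_λ) for λ ∈ 𝔫* partition Irr(G); and if {ν_i} is any set of elements of 𝔫* such that 𝔫* is the disjoint union of the sets Ξ_{ν_i}, then the character ρ_G of the regular representation of G (ρ_G(1) = |G| and ρ_G(g) = 0 for g ≠ 1) decomposes as ρ_G = Σ_i (|G|/|S̄_{ν_i}|)·ξ_{ν_i}. -/

import Mathlib

open scoped Classical BigOperators ComplexOrder

set_option linter.unusedSectionVars false
set_option linter.unusedVariables false

noncomputable section

namespace IterChar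

/-! ### Generic notions for finite groups: inner product, induction, characters -/

/-- The standard inner product `⟨f,h⟩_G = |G|⁻¹ ∑_{x ∈ G} f x * conj (h x)`. -/
def innerG (G : Type) [Group G] (f h : G → ℂ) : ℂ :=
  (Nat.card G : ℂ)⁻¹ * ∑ᶠ x : G, f x * (starRingEnd ℂ) (h x)

/-- Induction of a function from a subgroup, via the Frobenius formula. -/
def indFun {G : Type} [Group G] (H : Subgroup G) (ψ : ↥H → ℂ) : G → ℂ :=
  fun g => (Nat.card ↥H : ℂ)⁻¹ *
    ∑ᶠ x : G, if h : x * g * x⁻¹ ∈ H then ψ ⟨x * g * x⁻¹, h⟩ else 0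

/-- A function `G → ℂ` is a character if it is the trace character of some
finite-dimensional complex representation. -/
def IsCharacter (G : Type) [Group G] (f : G → ℂ) : Prop :=
  ∃ V : FDRep ℂ G, f = FDRep.character V

/-- The set of irreducible characters of `G`: characters of norm one. -/
def Irr (G : Type) [Group G] : Set (G → ℂ) :=
  {f | IsCharacter G f ∧ innerG G f f = 1}

/-- The set of irreducible constituents of `χ`: irreducible characters with
`⟨χ, ψ⟩_G > 0` (using the complex partial order). -/
def IrrConstituents (G : Type) [Group G] (χ : G → ℂ) : Set (G → ℂ) :=
  {f | f ∈ Irr G ∧ 0 < innerG G χ f}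

/-! ### Algebra groups -/

variable {F : Type} [Field F] [Fintype F] {R : Type} [Ring R] [Algebra F R] [Fintype R]

/-- `J` is a nilpotent (non-unital) subalgebra: all products of some fixed length vanish. -/
def IsNil (J : NonUnitalSubalgebra F R) : Prop :=
  ∃ N : ℕ, ∀ l : List R, (∀ x ∈ l, x ∈ J) → l.length = N → l.prod = 0

/-- The algebra group `G = 1 + J` of a (nilpotent) subalgebra `J ⊆ R`, realized as the
subgroup of units `u` of `R` with `u - 1 ∈ J` (and `u⁻¹ - 1 ∈ J`, which is automatic
when `J` is nilpotent). -/
def algGroup (F : Type) [Field F] [Fintype F] (R : Type) [Ring R] [Algebra F R] [Fintype R]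
    (J : NonUnitalSubalgebra F R) : Subgroup Rˣ where
  carrier := {u : Rˣ | ((u : R) - 1 ∈ J) ∧ (((u⁻¹ : Rˣ) : R) - 1 ∈ J)}
  one_mem' := by
    constructor <;> · simp only [Units.val_one, inv_one, sub_self]; exact J.zero_mem
  mul_mem' := by
    rintro u v ⟨hu1, hu2⟩ ⟨hv1, hv2⟩
    constructor
    · have h : ((u * v : Rˣ) : R) - 1 =
          ((u : R) - 1) * ((v : R) - 1) + ((u : R) - 1) + ((v : R) - 1) := by
        push_cast; noncomm_ring
      rw [h]
      exact add_mem (add_mem (mul_mem hu1 hv1) hu1) hv1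
    · have h : (((u * v)⁻¹ : Rˣ) : R) - 1 =
          (((v⁻¹ : Rˣ) : R) - 1) * (((u⁻¹ : Rˣ) : R) - 1) +
            (((v⁻¹ : Rˣ) : R) - 1) + (((u⁻¹ : Rˣ) : R) - 1) := by
        rw [mul_inv_rev]; push_cast; noncomm_ring
      rw [h]
      exact add_mem (add_mem (mul_mem hv2 hu2) hv2) hu2
  inv_mem' := by
    rintro u ⟨h1, h2⟩
    exact ⟨h2, by simpa using h1⟩

theorem mem_algGroup {J : NonUnitalSubalgebra F R} {u : Rˣ} :
    u ∈ algGroup F R J ↔ ((u : R) - 1 ∈ J) ∧ (((u⁻¹ : Rˣ) : R) - 1 ∈ J) :=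
  Iff.rfl

/-- The element `X ∈ J` such that `g = 1 + X`. -/
def gElt {J : NonUnitalSubalgebra F R} (g : ↥(algGroup F R J)) : ↥J :=
  ⟨((g : Rˣ) : R) - 1, g.2.1⟩

/-- The function `θ_λ(1+X) = θ(λ(X))` on the algebra group `1 + J`. -/
def thetaFn (θ : AddChar F ℂ) (J : NonUnitalSubalgebra F R) (lam : ↥J →ₗ[F] F) :
    ↥(algGroup F R J) → ℂ :=
  fun g => θ (lam (gElt g))

/-- Left multiplication by the group element `g` as a linear endomorphism of `J`. -/
def lmulMap {J : NonUnitalSubalgebra F R} (g : ↥(algGroup F R J)) : ↥J →ₗ[F] ↥J where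
  toFun X := ⟨((g : Rˣ) : R) * (X : R), by
    have h : ((g : Rˣ) : R) * (X : R) = (((g : Rˣ) : R) - 1) * (X : R) + (X : R) := by
      noncomm_ring
    rw [h]; exact add_mem (mul_mem g.2.1 X.2) X.2⟩
  map_add' X Y := by ext; simp [mul_add]
  map_smul' c X := by ext; simp [mul_smul_comm]

/-- Right multiplication by the group element `g` as a linear endomorphism of `J`. -/
def rmulMap {J : NonUnitalSubalgebra F R} (g : ↥(algGroup F R J)) : ↥J →ₗ[F] ↥J where
  toFun X := ⟨(X : R) * ((g : Rˣ) : R), by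
    have h : (X : R) * ((g : Rˣ) : R) = (X : R) * (((g : Rˣ) : R) - 1) + (X : R) := by
      noncomm_ring
    rw [h]; exact add_mem (mul_mem X.2 g.2.1) X.2⟩
  map_add' X Y := by ext; simp [add_mul]
  map_smul' c X := by ext; simp [smul_mul_assoc]

/-- The left action of `G` on the dual space: `(gλ)(X) = λ(g⁻¹ X)`. -/
def leftAct {J : NonUnitalSubalgebra F R} (g : ↥(algGroup F R J)) (lam : ↥J →ₗ[F] F) :
    ↥J →ₗ[F] F :=
  lam.comp (lmulMap g⁻¹)

/-- The right action of `G` on the dual space: `(λg)(X) = λ(X g⁻¹)`. -/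
def rightAct {J : NonUnitalSubalgebra F R} (g : ↥(algGroup F R J)) (lam : ↥J →ₗ[F] F) :
    ↥J →ₗ[F] F :=
  lam.comp (rmulMap g⁻¹)

/-- The coadjoint action of `G` on the dual space: `λ^g(X) = λ(g X g⁻¹)`. -/
def coAct {J : NonUnitalSubalgebra F R} (g : ↥(algGroup F R J)) (lam : ↥J →ₗ[F] F) :
    ↥J →ₗ[F] F :=
  lam.comp ((lmulMap g).comp (rmulMap g⁻¹))

/-- The left orbit `Gλ`. -/
def leftOrbit (J : NonUnitalSubalgebra F R) (lam : ↥J →ₗ[F] F) : Set (↥J →ₗ[F] F) :=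
  Set.range fun g : ↥(algGroup F R J) => leftAct g lam

/-- The right orbit `λG`. -/
def rightOrbit (J : NonUnitalSubalgebra F R) (lam : ↥J →ₗ[F] F) : Set (↥J →ₗ[F] F) :=
  Set.range fun g : ↥(algGroup F R J) => rightAct g lam

/-- The two-sided orbit `GλG`. -/
def twoOrbit (J : NonUnitalSubalgebra F R) (lam : ↥J →ₗ[F] F) : Set (↥J →ₗ[F] F) :=
  {mu | ∃ g h : ↥(algGroup F R J), mu = leftAct g (rightAct h lam)}

/-- The coadjoint orbit `λ^G`. -/
def coOrbit (J : NonUnitalSubalgebra F R) (lam : ↥J →ₗ[F] F) : Set (↥J →ₗ[F] F) :=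
  Set.range fun g : ↥(algGroup F R J) => coAct g lam

/-- The right orbit of `λ` under a subgroup `H` of the algebra group. -/
def rightOrbitUnder (J : NonUnitalSubalgebra F R) (H : Subgroup ↥(algGroup F R J))
    (lam : ↥J →ₗ[F] F) : Set (↥J →ₗ[F] F) :=
  {mu | ∃ s ∈ H, mu = rightAct s lam}

/-- The Kirillov function `ψ_λ = |λ^G|^{-1/2} ∑_{μ ∈ λ^G} θ_μ`. -/
def kirillov (θ : AddChar F ℂ) (J : NonUnitalSubalgebra F R) (lam : ↥J →ₗ[F] F) :
    ↥(algGroup F R J) → ℂ :=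
  fun g => ((Real.sqrt (Nat.card ↥(coOrbit J lam)) : ℂ))⁻¹ *
    ∑ᶠ mu ∈ coOrbit J lam, thetaFn θ J mu g

/-- The supercharacter `χ_λ = (|Gλ|/|GλG|) ∑_{μ ∈ GλG} θ_μ`. -/
def superchar (θ : AddChar F ℂ) (J : NonUnitalSubalgebra F R) (lam : ↥J →ₗ[F] F) :
    ↥(algGroup F R J) → ℂ :=
  fun g => ((Nat.card ↥(leftOrbit J lam) : ℂ) / (Nat.card ↥(twoOrbit J lam) : ℂ)) *
    ∑ᶠ mu ∈ twoOrbit J lam, thetaFn θ J mu g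

/-! ### The subalgebras `𝔩_λ`, `𝔰_λ` and their iterates -/

/-- The extension of `λ : J → F` by zero to all of `R`. -/
def lamE (J : NonUnitalSubalgebra F R) (lam : ↥J →ₗ[F] F) (x : R) : F :=
  if h : x ∈ J then lam ⟨x, h⟩ else 0

theorem lamE_apply (J : NonUnitalSubalgebra F R) (lam : ↥J →ₗ[F] F) {x : R} (hx : x ∈ J) :
    lamE J lam x = lam ⟨x, hx⟩ := dif_pos hx

theorem lamE_zero (J : NonUnitalSubalgebra F R) (lam : ↥J →ₗ[F] F) : lamE J lam 0 = 0 := by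
  rw [lamE_apply J lam J.zero_mem]
  have h : (⟨(0 : R), J.zero_mem⟩ : ↥J) = 0 := Subtype.ext rfl
  rw [h, map_zero]

theorem lamE_add (J : NonUnitalSubalgebra F R) (lam : ↥J →ₗ[F] F) {x y : R}
    (hx : x ∈ J) (hy : y ∈ J) : lamE J lam (x + y) = lamE J lam x + lamE J lam y := by
  rw [lamE, lamE, lamE, dif_pos (add_mem hx hy), dif_pos hx, dif_pos hy]
  have h : (⟨x + y, add_mem hx hy⟩ : ↥J) = ⟨x, hx⟩ + ⟨y, hy⟩ := Subtype.ext rfl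
  rw [h, map_add]

theorem lamE_smul (J : NonUnitalSubalgebra F R) (lam : ↥J →ₗ[F] F) (c : F) {x : R}
    (hx : x ∈ J) : lamE J lam (c • x) = c * lamE J lam x := by
  rw [lamE, lamE, dif_pos (SMulMemClass.smul_mem c hx), dif_pos hx]
  have h : (⟨c • x, SMulMemClass.smul_mem c hx⟩ : ↥J) = c • ⟨x, hx⟩ := Subtype.ext rfl
  rw [h, map_smul]
  rfl

/-- The left kernel `𝔩` of the bilinear form `(X,Y) ↦ λ(XY)` restricted to `s × s`. -/
def lStep (J : NonUnitalSubalgebra F R) (lam : ↥J →ₗ[F] F)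
    (s : NonUnitalSubalgebra F R) (hs : s ≤ J) : NonUnitalSubalgebra F R where
  carrier := {x | x ∈ s ∧ ∀ y ∈ s, lamE J lam (x * y) = 0}
  zero_mem' := ⟨zero_mem s, fun y _ => by rw [zero_mul, lamE_zero]⟩
  add_mem' := by
    rintro a b ⟨ha1, ha2⟩ ⟨hb1, hb2⟩
    refine ⟨add_mem ha1 hb1, fun y hy => ?_⟩
    rw [add_mul, lamE_add J lam (J.mul_mem (hs ha1) (hs hy)) (J.mul_mem (hs hb1) (hs hy)),
      ha2 y hy, hb2 y hy, add_zero]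
  smul_mem' := by
    rintro c a ⟨ha1, ha2⟩
    refine ⟨SMulMemClass.smul_mem c ha1, fun y hy => ?_⟩
    rw [smul_mul_assoc, lamE_smul J lam c (J.mul_mem (hs ha1) (hs hy)), ha2 y hy, mul_zero]
  mul_mem' := by
    rintro a b ⟨ha1, ha2⟩ ⟨hb1, hb2⟩
    refine ⟨mul_mem ha1 hb1, fun y hy => ?_⟩
    rw [mul_assoc]
    exact ha2 (b * y) (mul_mem hb1 hy)

theorem lStep_le (J : NonUnitalSubalgebra F R) (lam : ↥J →ₗ[F] F)
    (s : NonUnitalSubalgebra F R) (hs : s ≤ J) : lStep J lam s hs ≤ s :=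
  fun _ hx => hx.1

/-- The left kernel `𝔰` of the bilinear form `(X,Y) ↦ λ(XY)` restricted to `s × 𝔩`. -/
def sStep (J : NonUnitalSubalgebra F R) (lam : ↥J →ₗ[F] F)
    (s : NonUnitalSubalgebra F R) (hs : s ≤ J) : NonUnitalSubalgebra F R where
  carrier := {x | x ∈ s ∧ ∀ y ∈ lStep J lam s hs, lamE J lam (x * y) = 0}
  zero_mem' := ⟨zero_mem s, fun y _ => by rw [zero_mul, lamE_zero]⟩
  add_mem' := by
    rintro a b ⟨ha1, ha2⟩ ⟨hb1, hb2⟩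
    refine ⟨add_mem ha1 hb1, fun y hy => ?_⟩
    rw [add_mul, lamE_add J lam (J.mul_mem (hs ha1) (hs hy.1)) (J.mul_mem (hs hb1) (hs hy.1)),
      ha2 y hy, hb2 y hy, add_zero]
  smul_mem' := by
    rintro c a ⟨ha1, ha2⟩
    refine ⟨SMulMemClass.smul_mem c ha1, fun y hy => ?_⟩
    rw [smul_mul_assoc, lamE_smul J lam c (J.mul_mem (hs ha1) (hs hy.1)), ha2 y hy, mul_zero]
  mul_mem' := by
    rintro a b ⟨ha1, ha2⟩ ⟨hb1, hb2⟩
    refine ⟨mul_mem ha1 hb1, fun y hy => ?_⟩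
    rw [mul_assoc]
    refine ha2 (b * y) ⟨mul_mem hb1 hy.1, fun z hz => ?_⟩
    rw [mul_assoc]
    refine hb2 (y * z) ⟨mul_mem hy.1 hz, fun w hw => ?_⟩
    rw [mul_assoc]
    exact hy.2 (z * w) (mul_mem hz hw)

theorem sStep_le (J : NonUnitalSubalgebra F R) (lam : ↥J →ₗ[F] F)
    (s : NonUnitalSubalgebra F R) (hs : s ≤ J) : sStep J lam s hs ≤ s :=
  fun _ hx => hx.1

/-- `𝔩_λ`: the left kernel of `(X,Y) ↦ λ(XY)` on `J × J`. -/
def lone (J : NonUnitalSubalgebra F R) (lam : ↥J →ₗ[F] F) : NonUnitalSubalgebra F R :=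
  lStep J lam J le_rfl

/-- `𝔰_λ`: the left kernel of `(X,Y) ↦ λ(XY)` on `J × 𝔩_λ`. -/
def sone (J : NonUnitalSubalgebra F R) (lam : ↥J →ₗ[F] F) : NonUnitalSubalgebra F R :=
  sStep J lam J le_rfl

theorem lone_le (J : NonUnitalSubalgebra F R) (lam : ↥J →ₗ[F] F) : lone J lam ≤ J :=
  lStep_le J lam J le_rfl

theorem sone_le (J : NonUnitalSubalgebra F R) (lam : ↥J →ₗ[F] F) : sone J lam ≤ J :=
  sStep_le J lam J le_rfl

/-- `𝔨_λ = 𝔩_λ ∩ ker λ`. -/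
def kone (J : NonUnitalSubalgebra F R) (lam : ↥J →ₗ[F] F) : NonUnitalSubalgebra F R where
  carrier := {x | x ∈ lone J lam ∧ lamE J lam x = 0}
  zero_mem' := ⟨zero_mem _, lamE_zero J lam⟩
  add_mem' := by
    rintro a b ⟨ha1, ha2⟩ ⟨hb1, hb2⟩
    exact ⟨add_mem ha1 hb1, by
      rw [lamE_add J lam (lone_le J lam ha1) (lone_le J lam hb1), ha2, hb2, add_zero]⟩
  smul_mem' := by
    rintro c a ⟨ha1, ha2⟩
    exact ⟨SMulMemClass.smul_mem c ha1, by
      rw [lamE_smul J lam c (lone_le J lam ha1), ha2, mul_zero]⟩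
  mul_mem' := by
    rintro a b ⟨ha1, ha2⟩ ⟨hb1, hb2⟩
    exact ⟨mul_mem ha1 hb1, ha1.2 b (lone_le J lam hb1)⟩

theorem kone_le (J : NonUnitalSubalgebra F R) (lam : ↥J →ₗ[F] F) : kone J lam ≤ lone J lam :=
  fun _ hx => hx.1

/-- The descending chain `𝔰_λ^0 ⊇ 𝔰_λ^1 ⊇ ⋯` (bundled with the proof `𝔰_λ^i ≤ J`). -/
def sChainAux (J : NonUnitalSubalgebra F R) (lam : ↥J →ₗ[F] F) :
    ℕ → {s : NonUnitalSubalgebra F R // s ≤ J}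
  | 0 => ⟨J, le_rfl⟩
  | n + 1 =>
    ⟨sStep J lam (sChainAux J lam n).1 (sChainAux J lam n).2,
      le_trans (sStep_le J lam (sChainAux J lam n).1 (sChainAux J lam n).2)
        (sChainAux J lam n).2⟩

/-- `𝔰_λ^i`. -/
def sChain (J : NonUnitalSubalgebra F R) (lam : ↥J →ₗ[F] F) (i : ℕ) :
    NonUnitalSubalgebra F R :=
  (sChainAux J lam i).1

/-- `𝔩_λ^{i+1}`. -/
def lChain (J : NonUnitalSubalgebra F R) (lam : ↥J →ₗ[F] F) (i : ℕ) :
    NonUnitalSubalgebra F R :=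
  lStep J lam (sChainAux J lam i).1 (sChainAux J lam i).2

/-- The terminal element `𝔰̄_λ` of the descending chain; the chain has stabilized by
stage `|R|` since it is a weakly decreasing chain of subalgebras of the finite algebra. -/
def sbar (J : NonUnitalSubalgebra F R) (lam : ↥J →ₗ[F] F) : NonUnitalSubalgebra F R :=
  sChain J lam (Fintype.card R)

theorem sbar_le (J : NonUnitalSubalgebra F R) (lam : ↥J →ₗ[F] F) : sbar J lam ≤ J :=
  (sChainAux J lam (Fintype.card R)).2

/-- The terminal element `𝔩̄_λ` of the ascending chain. -/
def lbar (J : NonUnitalSubalgebra F R) (lam : ↥J →ₗ[F] F) : NonUnitalSubalgebra F R :=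
  lStep J lam (sbar J lam) (sbar_le J lam)

theorem lbar_le (J : NonUnitalSubalgebra F R) (lam : ↥J →ₗ[F] F) : lbar J lam ≤ J :=
  le_trans (lStep_le J lam _ _) (sbar_le J lam)

/-! ### Algebra subgroups of an algebra group -/

/-- The algebra subgroup `1 + k` of `1 + J`, as a subgroup of the ambient algebra group. -/
def algSubgroup (k J : NonUnitalSubalgebra F R) : Subgroup ↥(algGroup F R J) :=
  (algGroup F R k).subgroupOf (algGroup F R J)

/-- `L_λ = 1 + 𝔩_λ` as a subgroup of `G`. -/
def Lgrp (J : NonUnitalSubalgebra F R) (lam : ↥J →ₗ[F] F) : Subgroup ↥(algGroup F R J) :=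
  algSubgroup (lone J lam) J

/-- `S_λ = 1 + 𝔰_λ` as a subgroup of `G`. -/
def Sgrp (J : NonUnitalSubalgebra F R) (lam : ↥J →ₗ[F] F) : Subgroup ↥(algGroup F R J) :=
  algSubgroup (sone J lam) J

/-- `L̄_λ = 1 + 𝔩̄_λ` as a subgroup of `G`. -/
def Lbarg (J : NonUnitalSubalgebra F R) (lam : ↥J →ₗ[F] F) : Subgroup ↥(algGroup F R J) :=
  algSubgroup (lbar J lam) J

/-- `S̄_λ = 1 + 𝔰̄_λ` as a subgroup of `G`. -/
def Sbarg (J : NonUnitalSubalgebra F R) (lam : ↥J →ₗ[F] F) : Subgroup ↥(algGroup F R J) :=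
  algSubgroup (sbar J lam) J

/-- Passing from an element of the subgroup `1 + k ≤ 1 + J` to an element of the
algebra group `1 + k` in its own right. -/
def toAlg {k J : NonUnitalSubalgebra F R} (x : ↥(algSubgroup k J)) : ↥(algGroup F R k) :=
  ⟨((x : ↥(algGroup F R J)) : Rˣ), Subgroup.mem_subgroupOf.mp x.2⟩

/-- The linear inclusion of a smaller subalgebra. -/
def inclMap {s J : NonUnitalSubalgebra F R} (h : s ≤ J) : ↥s →ₗ[F] ↥J where
  toFun x := ⟨(x : R), h x.2⟩
  map_add' x y := rfl
  map_smul' c x := rfl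

/-- Restriction of a functional on `J` to a smaller subalgebra. -/
def resTo {s J : NonUnitalSubalgebra F R} (h : s ≤ J) (lam : ↥J →ₗ[F] F) : ↥s →ₗ[F] F :=
  lam.comp (inclMap h)

/-- The character `ξ_λ = Ind_{L̄_λ}^G (θ_λ)`. -/
def xi (θ : AddChar F ℂ) (J : NonUnitalSubalgebra F R) (lam : ↥J →ₗ[F] F) :
    ↥(algGroup F R J) → ℂ :=
  indFun (Lbarg J lam) (fun x => thetaFn θ J lam ↑x)

/-- The set `Ξ_λ = {g λ s g⁻¹ : g ∈ G, s ∈ S̄_λ}`. -/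
def Xi (J : NonUnitalSubalgebra F R) (lam : ↥J →ₗ[F] F) : Set (↥J →ₗ[F] F) :=
  {nu | ∃ g : ↥(algGroup F R J), ∃ s ∈ Sbarg J lam, nu = coAct g (rightAct s lam)}

/-! ### Normality of algebra subgroups coming from ideals -/

theorem conj_mem_aux (s a : NonUnitalSubalgebra F R)
    (hl : ∀ x ∈ s, ∀ y ∈ a, x * y ∈ a) (hr : ∀ y ∈ a, ∀ x ∈ s, y * x ∈ a)
    (u : Rˣ) (hu1 : (u : R) - 1 ∈ s) (hu2 : ((u⁻¹ : Rˣ) : R) - 1 ∈ s)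
    (x : Rˣ) (hx : (x : R) - 1 ∈ a) : ((u * x * u⁻¹ : Rˣ) : R) - 1 ∈ a := by
  have h1 : (u : R) * ((u⁻¹ : Rˣ) : R) = 1 := Units.mul_inv u
  have key : ((u * x * u⁻¹ : Rˣ) : R) - 1 =
      ((u : R) - 1) * ((x : R) - 1) * (((u⁻¹ : Rˣ) : R) - 1) +
        ((u : R) - 1) * ((x : R) - 1) + ((x : R) - 1) * (((u⁻¹ : Rˣ) : R) - 1) +
        ((x : R) - 1) := by
    push_cast
    calc (u : R) * (x : R) * ((u⁻¹ : Rˣ) : R) - 1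
        = (u : R) * (x : R) * ((u⁻¹ : Rˣ) : R) - (u : R) * ((u⁻¹ : Rˣ) : R) := by rw [h1]
      _ = _ := by noncomm_ring
  rw [key]
  exact add_mem (add_mem (add_mem (hr _ (hl _ hu1 _ hx) _ hu2) (hl _ hu1 _ hx))
    (hr _ hx _ hu2)) hx

theorem algSubgroup_normal (s a : NonUnitalSubalgebra F R)
    (hl : ∀ x ∈ s, ∀ y ∈ a, x * y ∈ a) (hr : ∀ y ∈ a, ∀ x ∈ s, y * x ∈ a) :
    ((algGroup F R a).subgroupOf (algGroup F R s)).Normal := by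
  constructor
  intro n hn g
  rw [Subgroup.mem_subgroupOf] at hn ⊢
  have hginv : ((g⁻¹ : ↥(algGroup F R s)) : Rˣ) = ((g : Rˣ))⁻¹ := rfl
  have hcoe : ((g * n * g⁻¹ : ↥(algGroup F R s)) : Rˣ) = (g : Rˣ) * (n : Rˣ) * ((g : Rˣ))⁻¹ := by
    push_cast [hginv]; rfl
  rw [mem_algGroup]
  constructor
  · rw [hcoe]
    exact conj_mem_aux s a hl hr (g : Rˣ) (g : ↥(algGroup F R s)).2.1 (g : ↥(algGroup F R s)).2.2
      (n : Rˣ) hn.1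
  · have hinv : (((g * n * g⁻¹ : ↥(algGroup F R s)) : Rˣ))⁻¹ =
        (g : Rˣ) * ((n : Rˣ))⁻¹ * ((g : Rˣ))⁻¹ := by
      rw [hcoe]; group
    rw [hinv]
    exact conj_mem_aux s a hl hr (g : Rˣ) (g : ↥(algGroup F R s)).2.1 (g : ↥(algGroup F R s)).2.2
      ((n : Rˣ))⁻¹ hn.2

theorem lone_mul_mem (J : NonUnitalSubalgebra F R) (lam : ↥J →ₗ[F] F)
    {y z : R} (hy : y ∈ lone J lam) (hz : z ∈ J) : y * z ∈ lone J lam := by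
  refine ⟨J.mul_mem (lone_le J lam hy) hz, fun w hw => ?_⟩
  rw [mul_assoc]
  exact hy.2 (z * w) (J.mul_mem hz hw)

theorem sone_mul_lone_mem (J : NonUnitalSubalgebra F R) (lam : ↥J →ₗ[F] F)
    {x y : R} (hx : x ∈ sone J lam) (hy : y ∈ lone J lam) : x * y ∈ lone J lam := by
  refine ⟨J.mul_mem (sone_le J lam hx) (lone_le J lam hy), fun w hw => ?_⟩
  rw [mul_assoc]
  exact hx.2 (y * w) (lone_mul_mem J lam hy hw)

theorem kone_ideal_left (J : NonUnitalSubalgebra F R) (lam : ↥J →ₗ[F] F) :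
    ∀ x ∈ sone J lam, ∀ y ∈ kone J lam, x * y ∈ kone J lam := by
  intro x hx y hy
  exact ⟨sone_mul_lone_mem J lam hx hy.1, hx.2 y hy.1⟩

theorem kone_ideal_right (J : NonUnitalSubalgebra F R) (lam : ↥J →ₗ[F] F) :
    ∀ y ∈ kone J lam, ∀ x ∈ sone J lam, y * x ∈ kone J lam := by
  intro y hy x hx
  exact ⟨lone_mul_mem J lam hy.1 (sone_le J lam hx), hy.1.2 x (sone_le J lam hx)⟩

/-- `K_λ = 1 + 𝔨_λ` as a (normal) subgroup of `S_λ = 1 + 𝔰_λ`. -/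
def KgrpIn (J : NonUnitalSubalgebra F R) (lam : ↥J →ₗ[F] F) :
    Subgroup ↥(algGroup F R (sone J lam)) :=
  (algGroup F R (kone J lam)).subgroupOf (algGroup F R (sone J lam))

instance KgrpIn_normal (J : NonUnitalSubalgebra F R) (lam : ↥J →ₗ[F] F) :
    (KgrpIn J lam).Normal :=
  algSubgroup_normal (sone J lam) (kone J lam) (kone_ideal_left J lam) (kone_ideal_right J lam)

/-- `L_λ = 1 + 𝔩_λ` as a (normal) subgroup of `S_λ = 1 + 𝔰_λ`. -/
def LgrpIn (J : NonUnitalSubalgebra F R) (lam : ↥J →ₗ[F] F) :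
    Subgroup ↥(algGroup F R (sone J lam)) :=
  (algGroup F R (lone J lam)).subgroupOf (algGroup F R (sone J lam))

instance LgrpIn_normal (J : NonUnitalSubalgebra F R) (lam : ↥J →ₗ[F] F) :
    (LgrpIn J lam).Normal :=
  algSubgroup_normal (sone J lam) (lone J lam)
    (fun x hx y hy => sone_mul_lone_mem J lam hx hy)
    (fun y hy x hx => lone_mul_mem J lam hy (sone_le J lam hx))

section FiniteGroup

variable {G : Type} [Group G] [Fintype G]

theorem innerG_eq_sum (f h : G → ℂ) :
    innerG G f h = (Nat.card G : ℂ)⁻¹ * ∑ x : G, f x * (starRingEnd ℂ) (h x) := by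
  rw [innerG, finsum_eq_sum_of_fintype]

theorem indFun_eq_sum (H : Subgroup G) (ψ : ↥H → ℂ) (g : G) :
    indFun H ψ g = (Nat.card ↥H : ℂ)⁻¹ *
      ∑ x : G, if h : x * g * x⁻¹ ∈ H then ψ ⟨x * g * x⁻¹, h⟩ else 0 := by
  rw [indFun, finsum_eq_sum_of_fintype]

theorem character_inv {V : Type} [AddCommGroup V] [Module ℂ V] [FiniteDimensional ℂ V]
    (ρ : Representation ℂ G V) (g : G) :
    ρ.character g⁻¹ = (starRingEnd ℂ) (ρ.character g) := by
  let b := Module.finBasis ℂ V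
  let A : G → Matrix _ _ ℂ := fun g => LinearMap.toMatrix b b (ρ g)
  have hA : ∀ x y, A (x * y) = A x * A y := fun x y => by
    simp only [A, map_mul]
    exact LinearMap.toMatrix_mul b _ _
  have hA1 : A 1 = 1 := by
    simp only [A, map_one]
    exact LinearMap.toMatrix_one b
  have htr : ∀ x, ρ.character x = (A x).trace := fun x =>
    LinearMap.trace_eq_matrix_trace ℂ b (ρ x)
  let H := ∑ x : G, (A x).conjTranspose * A x
  have hH : H.PosDef := by
    have h1 : H = (A 1).conjTranspose * A 1 +
        ∑ x ∈ Finset.univ.erase (1 : G), (A x).conjTranspose * A x := by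
      rw [Finset.add_sum_erase _ (fun x => (A x).conjTranspose * A x) (Finset.mem_univ _)]
    rw [h1, hA1]
    refine Matrix.PosDef.add_posSemidef (by simpa using Matrix.PosDef.one) ?_
    exact Matrix.posSemidef_sum _ fun x _ => Matrix.posSemidef_conjTranspose_mul_self _
  have hcomm : H * A g⁻¹ = (A g).conjTranspose * H := by
    simp only [H, Finset.sum_mul, Finset.mul_sum]
    refine Fintype.sum_equiv (Equiv.mulRight g⁻¹) _ _ fun x => ?_
    have hx : A x = A (x * g⁻¹) * A g := by rw [← hA]; simp
    simp only [Equiv.coe_mulRight]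
    rw [mul_assoc, ← hA]
    conv_lhs => rw [hx]
    rw [Matrix.conjTranspose_mul, mul_assoc]
  have hu : IsUnit H.det := (Matrix.isUnit_iff_isUnit_det _).mp hH.isUnit
  have h2 : A g⁻¹ = H⁻¹ * ((A g).conjTranspose * H) := by
    rw [← hcomm, ← mul_assoc, Matrix.nonsing_inv_mul _ hu, one_mul]
  rw [htr, htr, h2, Matrix.trace_mul_comm, mul_assoc, Matrix.mul_nonsing_inv _ hu, mul_one,
    Matrix.trace_conjTranspose]
  rfl

variable {V : Type} [AddCommGroup V] [Module ℂ V]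

/-- The projection of `V` onto the `χ`-isotypic part of its restriction to `H`. -/
def isotypicProj (ρ : Representation ℂ G V) (H : Subgroup G) (χ : ↥H →* ℂ) : V →ₗ[ℂ] V :=
  (Nat.card ↥H : ℂ)⁻¹ • ∑ h : ↥H, χ h • ρ (h : G)⁻¹

theorem isotypicProj_mul (ρ : Representation ℂ G V) (H : Subgroup G) (χ : ↥H →* ℂ) (x : ↥H) :
    isotypicProj ρ H χ * ρ x = χ x • isotypicProj ρ H χ := by
  rw [isotypicProj, smul_mul_assoc, smul_comm, Finset.sum_mul]
  congr 1
  rw [Finset.smul_sum]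
  refine Fintype.sum_equiv (Equiv.mulLeft (x⁻¹ : ↥H)) _ _ fun h => ?_
  simp only [Equiv.coe_mulLeft]
  rw [smul_mul_assoc, ← map_mul ρ, smul_smul, ← map_mul χ]
  simp

theorem mul_isotypicProj (ρ : Representation ℂ G V) (H : Subgroup G) (χ : ↥H →* ℂ) (x : ↥H) :
    ρ x * isotypicProj ρ H χ = χ x • isotypicProj ρ H χ := by
  rw [isotypicProj, mul_smul_comm, smul_comm, Finset.mul_sum]
  congr 1
  rw [Finset.smul_sum]
  refine Fintype.sum_equiv (Equiv.mulRight (x⁻¹ : ↥H)) _ _ fun h => ?_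
  simp only [Equiv.coe_mulRight]
  rw [mul_smul_comm, ← map_mul ρ, smul_smul, mul_comm (χ x), ← map_mul χ]
  simp

theorem isotypicProj_idem (ρ : Representation ℂ G V) (H : Subgroup G) (χ : ↥H →* ℂ) :
    IsIdempotentElem (isotypicProj ρ H χ) := by
  have hc : (Nat.card ↥H : ℂ) ≠ 0 := Nat.cast_ne_zero.mpr Nat.card_pos.ne'
  have hx : ∀ x : ↥H, (χ x • ρ (x : G)⁻¹) * isotypicProj ρ H χ = isotypicProj ρ H χ := by
    intro x
    have := mul_isotypicProj ρ H χ x⁻¹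
    rw [Subgroup.coe_inv] at this
    rw [smul_mul_assoc, this, smul_smul, ← map_mul, mul_inv_cancel, map_one, one_smul]
  rw [IsIdempotentElem]
  conv_lhs => enter [1]; rw [isotypicProj]
  rw [smul_mul_assoc, Finset.sum_mul, Finset.sum_congr rfl fun x _ => hx x]
  rw [Finset.sum_const, Finset.card_univ, ← Nat.card_eq_fintype_card, ← Nat.cast_smul_eq_nsmul ℂ,
    smul_smul, inv_mul_cancel₀ hc, one_smul]

theorem sum_dite_mem_subgroup {M : Type*} [AddCommMonoid M] (H : Subgroup G) (f : ↥H → M) :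
    ∑ g : G, (if h : g ∈ H then f ⟨g, h⟩ else 0) = ∑ h : ↥H, f h := by
  rw [Finset.sum_dite, Finset.sum_const_zero, add_zero]
  exact Fintype.sum_equiv (Equiv.subtypeEquivRight (by simp)) _ _ fun _ => rfl

variable [FiniteDimensional ℂ V]

theorem innerG_indFun (ρ : Representation ℂ G V) (H : Subgroup G) (χ : ↥H →* ℂ) :
    innerG G (indFun H χ) ρ.character = LinearMap.trace ℂ V (isotypicProj ρ H χ) := by
  have hc : (Nat.card G : ℂ) ≠ 0 := Nat.cast_ne_zero.mpr Nat.card_pos.ne'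
  have key : ∀ y : G, (∑ g : G, (if h : y * g * y⁻¹ ∈ H then χ ⟨y * g * y⁻¹, h⟩ else 0) *
      ρ.character g⁻¹) = ∑ h : ↥H, χ h * ρ.character (h : G)⁻¹ := by
    intro y
    rw [← sum_dite_mem_subgroup]
    refine Fintype.sum_equiv (MulAut.conj y).toEquiv _ _ fun g => ?_
    have h1 : (MulAut.conj y).toEquiv g = y * g * y⁻¹ := rfl
    have h2 : ρ.character (y * g * y⁻¹)⁻¹ = ρ.character g⁻¹ := by
      rw [← Representation.char_conj ρ g⁻¹ y]
      group
    rw [h1, ← h2]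
    split_ifs <;> simp
  have htr : LinearMap.trace ℂ V (isotypicProj ρ H χ) =
      (Nat.card ↥H : ℂ)⁻¹ * ∑ h : ↥H, χ h * ρ.character (h : G)⁻¹ := by
    simp [isotypicProj, Representation.character]
  rw [innerG_eq_sum, htr]
  simp only [← character_inv, indFun_eq_sum]
  simp_rw [mul_assoc (Nat.card ↥H : ℂ)⁻¹, Finset.sum_mul]
  rw [← Finset.mul_sum, Finset.sum_comm, Finset.sum_congr rfl fun y _ => key y]
  rw [Finset.sum_const, Finset.card_univ, ← Nat.card_eq_fintype_card, nsmul_eq_mul]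
  field_simp

theorem exists_innerG_indFun_eq (ρ : Representation ℂ G V) (H : Subgroup G) (χ : ↥H →* ℂ) :
    ∃ n : ℕ, innerG G (indFun H χ) ρ.character = n :=
  ⟨_, (innerG_indFun ρ H χ).trans
    (LinearMap.IsIdempotentElem.isProj_range _ (isotypicProj_idem ρ H χ)).trace⟩

theorem exists_eq_smul_one_of_commute (ρ : Representation ℂ G V)
    (hρ : innerG G ρ.character ρ.character = 1) (T : V →ₗ[ℂ] V)
    (hT : ∀ g, T * ρ g = ρ g * T) : ∃ c : ℂ, T = c • 1 := by
  have hc : (Nat.card G : ℂ) ≠ 0 := Nat.cast_ne_zero.mpr Nat.card_pos.ne'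
  have : Invertible (Nat.card G : ℂ) := invertibleOfNonzero hc
  have h1 : Module.finrank ℂ (Representation.IntertwiningMap ρ ρ) = 1 := by
    have := Representation.card_inv_mul_sum_char_mul_char_eq_finrank ρ ρ
    simp only [character_inv] at this
    rw [← innerG_eq_sum, hρ] at this
    exact_mod_cast this.symm
  let I : Representation.IntertwiningMap ρ ρ := ⟨1, fun g => rfl⟩
  let T' : Representation.IntertwiningMap ρ ρ := ⟨T, hT⟩
  have hI : I ≠ 0 := by
    intro h0
    have hz : (1 : V →ₗ[ℂ] V) = 0 := congrArg (fun f => f.toLinearMap) h0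
    have htr : ∀ g, ρ.character g = 0 := fun g => by
      rw [Representation.character, ← one_mul (ρ g), hz, zero_mul, map_zero]
    rw [innerG_eq_sum] at hρ
    simp [htr] at hρ
  obtain ⟨c, hc⟩ := (finrank_eq_one_iff_of_nonzero' I hI).mp h1 T'
  exact ⟨c, (congrArg (fun f => f.toLinearMap) hc).symm⟩

theorem exists_double_coset_compat (ρ : Representation ℂ G V)
    (hρ : innerG G ρ.character ρ.character = 1) (H K : Subgroup G) (χ : ↥H →* ℂ) (ψ : ↥K →* ℂ)
    (hH : innerG G (indFun H χ) ρ.character ≠ 0) (hK : innerG G (indFun K ψ) ρ.character ≠ 0) :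
    ∃ g : G, ∀ (x : ↥H) (y : ↥K), (x : G) * g = g * y → χ x = ψ y := by
  have hc : (Nat.card G : ℂ) ≠ 0 := Nat.cast_ne_zero.mpr Nat.card_pos.ne'
  by_contra! hcon
  rw [innerG_indFun] at hH hK
  set P := isotypicProj ρ H χ with hP
  set Q := isotypicProj ρ K ψ with hQ
  have hPQ : ∀ g, P * ρ g * Q = 0 := by
    intro g
    obtain ⟨x, y, hxy, hne⟩ := hcon g
    have h1 : P * ρ x * ρ g * Q = χ x • (P * ρ g * Q) := by
      rw [hP, isotypicProj_mul, smul_mul_assoc, smul_mul_assoc]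
    have h2 : P * ρ x * ρ g * Q = ψ y • (P * ρ g * Q) := by
      rw [mul_assoc P, ← map_mul, hxy, map_mul, ← mul_assoc, mul_assoc _ _ Q, hQ,
        mul_isotypicProj, mul_smul_comm]
    have h3 : (χ x - ψ y) • (P * ρ g * Q) = 0 := by rw [sub_smul, ← h1, h2, sub_self]
    exact (smul_eq_zero.mp h3).resolve_left (sub_ne_zero.mpr hne)
  let T := ∑ g : G, ρ g * Q * ρ g⁻¹
  have hT : ∀ g, T * ρ g = ρ g * T := by
    intro g
    simp only [T, Finset.sum_mul, Finset.mul_sum]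
    refine Fintype.sum_equiv (Equiv.mulLeft g⁻¹) _ _ fun x => ?_
    simp only [Equiv.coe_mulLeft, mul_inv_rev, inv_inv, map_mul, ← mul_assoc]
    rw [← map_mul ρ g g⁻¹, mul_inv_cancel, map_one, one_mul]
  obtain ⟨c, hcT⟩ := exists_eq_smul_one_of_commute ρ hρ T hT
  have htr : LinearMap.trace ℂ V T = Nat.card G * LinearMap.trace ℂ V Q := by
    simp only [T, map_sum]
    rw [Finset.sum_congr rfl fun g _ => ?_, Finset.sum_const, Finset.card_univ,
      ← Nat.card_eq_fintype_card, nsmul_eq_mul]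
    rw [LinearMap.trace_mul_comm, ← mul_assoc, ← map_mul, inv_mul_cancel, map_one, one_mul]
  have hc0 : c ≠ 0 := by
    rintro rfl
    rw [hcT, zero_smul, map_zero] at htr
    exact mul_ne_zero hc hK htr.symm
  have hPT : P * T = 0 := by
    simp only [T, Finset.mul_sum]
    exact Finset.sum_eq_zero fun g _ => by rw [← mul_assoc, ← mul_assoc, hPQ, zero_mul]
  rw [hcT, mul_smul_comm, mul_one] at hPT
  rw [(smul_eq_zero.mp hPT).resolve_left hc0, map_zero] at hH
  exact hH rfl

theorem compat_of_mem_irrConstituents (H K : Subgroup G) (χ : ↥H →* ℂ) (ψ : ↥K →* ℂ)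
    (f : G → ℂ) (hH : f ∈ IrrConstituents G (indFun H χ)) (hK : f ∈ IrrConstituents G (indFun K ψ)) :
    ∃ g : G, ∀ (x : ↥H) (y : ↥K), (x : G) * g = g * y → χ x = ψ y := by
  obtain ⟨⟨⟨V, rfl⟩, hf⟩, h1⟩ := hH
  exact exists_double_coset_compat V.ρ hf H K χ ψ h1.ne' hK.2.ne'

theorem innerG_indFun_pos (H : Subgroup G) (χ : ↥H →* ℂ)
    (f : G → ℂ) (hf : IsCharacter G f) (h : innerG G (indFun H χ) f ≠ 0) :
    0 < innerG G (indFun H χ) f := by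
  obtain ⟨V, rfl⟩ := hf
  obtain ⟨n, hn⟩ := exists_innerG_indFun_eq V.ρ H χ
  have hn' : innerG G (indFun H χ) V.character = n := hn
  rw [hn'] at h ⊢
  exact_mod_cast Nat.pos_of_ne_zero (by exact_mod_cast h)

theorem Irr.apply_one_ne_zero {f : G → ℂ} (hf : f ∈ Irr G) : f 1 ≠ 0 := by
  obtain ⟨⟨V, rfl⟩, h⟩ := hf
  intro h0
  rw [FDRep.char_one, Nat.cast_eq_zero] at h0
  have := Module.finrank_zero_iff.mp h0
  have htr : ∀ g, V.character g = 0 := fun g => by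
    have : V.ρ g = 0 := Subsingleton.elim _ _
    rw [FDRep.character, this, map_zero]
  rw [innerG_eq_sum] at h
  simp [htr] at h

end FiniteGroup

section Chains

variable {J : NonUnitalSubalgebra F R} (lam : ↥J →ₗ[F] F)

theorem lamE_coe (x : ↥J) : lamE J lam x = lam x := lamE_apply J lam x.2

theorem mem_lChain {i : ℕ} {x : R} : x ∈ lChain J lam i ↔
    x ∈ sChain J lam i ∧ ∀ y ∈ sChain J lam i, lamE J lam (x * y) = 0 := Iff.rfl

theorem mem_sChain_succ {i : ℕ} {x : R} : x ∈ sChain J lam (i + 1) ↔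
    x ∈ sChain J lam i ∧ ∀ y ∈ lChain J lam i, lamE J lam (x * y) = 0 := Iff.rfl

theorem sChain_le (i : ℕ) : sChain J lam i ≤ J := (sChainAux J lam i).2

theorem lChain_le_sChain (i : ℕ) : lChain J lam i ≤ sChain J lam i := fun _ h => h.1

theorem sChain_succ_le (i : ℕ) : sChain J lam (i + 1) ≤ sChain J lam i := fun _ h => h.1

theorem sChain_antitone : Antitone (sChain J lam) := antitone_nat_of_succ_le (sChain_succ_le lam)

theorem lChain_le_sChain_succ (i : ℕ) : lChain J lam i ≤ sChain J lam (i + 1) :=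
  fun _ h => ⟨h.1, fun y hy => h.2 y hy.1⟩

theorem lChain_monotone : Monotone (lChain J lam) :=
  monotone_nat_of_le_succ fun i _ h =>
    ⟨lChain_le_sChain_succ lam i h, fun y hy => h.2 y (sChain_succ_le lam i hy)⟩

theorem lChain_mul_sChain {i : ℕ} {x y : R} (hx : x ∈ lChain J lam i)
    (hy : y ∈ sChain J lam i) : x * y ∈ lChain J lam i :=
  ⟨mul_mem hx.1 hy, fun z hz => by rw [mul_assoc]; exact hx.2 _ (mul_mem hy hz)⟩

theorem mem_lChain_of_forall {i : ℕ} {x : R} (hx : x ∈ J)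
    (h : ∀ y ∈ sChain J lam i, lamE J lam (x * y) = 0) : x ∈ lChain J lam i := by
  have key : ∀ j ≤ i, x ∈ sChain J lam j := by
    intro j
    induction j with
    | zero => exact fun _ => hx
    | succ j ih =>
      intro hj
      refine ⟨ih (by omega), fun y hy => h y ?_⟩
      exact lChain_le_sChain lam i (lChain_monotone lam (by omega : j ≤ i) hy)
  exact ⟨key i le_rfl, h⟩

theorem sChain_succ_eq_of_eq {i : ℕ} (h : sChain J lam (i + 1) = sChain J lam i) (j : ℕ)
    (hj : i ≤ j) : sChain J lam (j + 1) = sChain J lam j := by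
  induction j, hj using Nat.le_induction with
  | base => exact h
  | succ j _ ih =>
    ext x
    have hl : lChain J lam (j + 1) = lChain J lam j := by
      ext x; rw [mem_lChain, mem_lChain, ih]
    rw [mem_sChain_succ, hl, ih, ← mem_sChain_succ, ih]

theorem sChain_card_succ :
    sChain J lam (Fintype.card R + 1) = sChain J lam (Fintype.card R) := by
  by_contra hne
  have hlt : ∀ i ≤ Fintype.card R, sChain J lam (i + 1) ≠ sChain J lam i :=
    fun i hi h => hne (sChain_succ_eq_of_eq lam h _ hi)
  have hcard : ∀ i ≤ Fintype.card R,
      (sChain J lam i : Set R).ncard + i ≤ Fintype.card R := by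
    intro i
    induction i with
    | zero =>
      intro _
      rw [add_zero, ← Nat.card_eq_fintype_card]
      exact Set.ncard_le_card _
    | succ i ih =>
      intro hi
      have h1 := ih (by omega)
      have h2 : (sChain J lam (i + 1) : Set R).ncard < (sChain J lam i : Set R).ncard :=
        Set.ncard_lt_ncard (lt_of_le_of_ne (sChain_succ_le lam i)
          fun h => hlt i (by omega) (SetLike.coe_injective h)) (Set.toFinite _)
      omega
  have h0 : 0 < (sChain J lam (Fintype.card R) : Set R).ncard :=
    (Set.ncard_pos (Set.toFinite _)).mpr ⟨0, zero_mem _⟩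
  have := hcard _ le_rfl
  omega

theorem lamE_mul_eq_zero {x y : R} (hx : x ∈ sbar J lam) (hy : y ∈ lbar J lam) :
    lamE J lam (x * y) = 0 := by
  have hx' : x ∈ sChain J lam (Fintype.card R + 1) := by rw [sChain_card_succ]; exact hx
  exact hx'.2 y hy

theorem mem_lbar_of_forall {x : R} (hx : x ∈ J)
    (h : ∀ y ∈ sbar J lam, lamE J lam (x * y) = 0) : x ∈ lbar J lam :=
  mem_lChain_of_forall lam hx h

end Chains

section Groups

theorem mem_algGroup_iff {k : NonUnitalSubalgebra F R} {u : Rˣ} :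
    u ∈ algGroup F R k ↔ (u : R) - 1 ∈ k := by
  refine ⟨fun h => h.1, fun h => ⟨h, ?_⟩⟩
  have hpow : ∀ n : ℕ, ((u ^ n : Rˣ) : R) - 1 ∈ k := by
    intro n
    induction n with
    | zero => simp
    | succ n ih =>
      have h' : ((u ^ (n + 1) : Rˣ) : R) - 1 =
          (((u ^ n : Rˣ) : R) - 1) * ((u : R) - 1) + (((u ^ n : Rˣ) : R) - 1) + ((u : R) - 1) := by
        rw [pow_succ]; push_cast; noncomm_ring
      rw [h']
      exact add_mem (add_mem (mul_mem ih h) ih) h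
  have hu : u⁻¹ = u ^ (orderOf u - 1) := by
    rw [inv_eq_iff_mul_eq_one, ← pow_succ', Nat.sub_add_cancel (orderOf_pos u), pow_orderOf_eq_one]
  rw [hu]
  exact hpow _

theorem mul_mem_of_mem_algGroup {k : NonUnitalSubalgebra F R} {u : Rˣ} (hu : u ∈ algGroup F R k)
    {x : R} (hx : x ∈ k) : x * u ∈ k := by
  have : x * (u : R) = x * ((u : R) - 1) + x := by noncomm_ring
  rw [this]
  exact add_mem (mul_mem hx hu.1) hx

variable {J : NonUnitalSubalgebra F R}

theorem mem_algSubgroup {k : NonUnitalSubalgebra F R} {g : ↥(algGroup F R J)} :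
    g ∈ algSubgroup k J ↔ (gElt g : R) ∈ k := by
  rw [algSubgroup, Subgroup.mem_subgroupOf, mem_algGroup_iff]
  rfl

theorem algSubgroup_mono {k l : NonUnitalSubalgebra F R} (h : k ≤ l) :
    algSubgroup k J ≤ algSubgroup l J := fun _ hg => mem_algSubgroup.mpr (h (mem_algSubgroup.mp hg))

theorem gElt_injective : Function.Injective (gElt : ↥(algGroup F R J) → ↥J) := by
  intro g h hgh
  have : ((g : Rˣ) : R) - 1 = ((h : Rˣ) : R) - 1 := congrArg Subtype.val hgh
  exact Subtype.ext (Units.ext (sub_left_injective this))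

theorem IsNil.gElt_surjective (hJ : IsNil J) :
    Function.Surjective (gElt : ↥(algGroup F R J) → ↥J) := by
  rintro ⟨x, hx⟩
  obtain ⟨N, hN⟩ := hJ
  have hnil : IsNilpotent x := ⟨N, by
    have := hN (List.replicate N x) (fun y hy => (List.eq_of_mem_replicate hy) ▸ hx) (by simp)
    simpa using this⟩
  obtain ⟨u, hu⟩ := hnil.isUnit_one_add
  have hux : (u : R) - 1 = x := by rw [hu]; simp
  exact ⟨⟨u, mem_algGroup_iff.mpr (hux ▸ hx)⟩, Subtype.ext hux⟩

theorem IsNil.bijective_algSubgroup (hJ : IsNil J) {k : NonUnitalSubalgebra F R} (hk : k ≤ J) :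
    Function.Bijective (fun s : ↥(algSubgroup k J) =>
      (⟨gElt (s : ↥(algGroup F R J)), mem_algSubgroup.mp s.2⟩ : ↥k)) := by
  constructor
  · intro s t hst
    exact Subtype.ext (gElt_injective (Subtype.ext (congrArg (fun y : ↥k => (y : R)) hst)))
  · rintro ⟨x, hx⟩
    obtain ⟨g, hg⟩ := hJ.gElt_surjective ⟨x, hk hx⟩
    have hgx : (gElt g : R) = x := congrArg Subtype.val hg
    exact ⟨⟨g, mem_algSubgroup.mpr (hgx ▸ hx)⟩, Subtype.ext hgx⟩

theorem IsNil.card_algGroup (hJ : IsNil J) : Nat.card ↥(algGroup F R J) = Nat.card ↥J :=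
  Nat.card_eq_of_bijective _ ⟨gElt_injective, hJ.gElt_surjective⟩

theorem IsNil.card_algSubgroup (hJ : IsNil J) {k : NonUnitalSubalgebra F R} (hk : k ≤ J) :
    Nat.card ↥(algSubgroup k J) = Nat.card ↥k :=
  Nat.card_eq_of_bijective _ (hJ.bijective_algSubgroup hk)

theorem rmulMap_mul (g h : ↥(algGroup F R J)) (x : ↥J) :
    rmulMap (g * h) x = rmulMap h (rmulMap g x) := by
  ext; simp [rmulMap, mul_assoc]

theorem lmulMap_mul (g h : ↥(algGroup F R J)) (x : ↥J) :
    lmulMap (g * h) x = lmulMap g (lmulMap h x) := by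
  ext; simp [lmulMap, mul_assoc]

theorem lmulMap_rmulMap (g h : ↥(algGroup F R J)) (x : ↥J) :
    lmulMap g (rmulMap h x) = rmulMap h (lmulMap g x) := by
  ext; simp [lmulMap, rmulMap, mul_assoc]

@[simp] theorem rmulMap_one (x : ↥J) : rmulMap (1 : ↥(algGroup F R J)) x = x := by
  ext; simp [rmulMap]

@[simp] theorem lmulMap_one (x : ↥J) : lmulMap (1 : ↥(algGroup F R J)) x = x := by
  ext; simp [lmulMap]

@[simp] theorem rmulMap_inv_rmulMap (g : ↥(algGroup F R J)) (x : ↥J) :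
    rmulMap g⁻¹ (rmulMap g x) = x := by rw [← rmulMap_mul, mul_inv_cancel, rmulMap_one]

@[simp] theorem rmulMap_rmulMap_inv (g : ↥(algGroup F R J)) (x : ↥J) :
    rmulMap g (rmulMap g⁻¹ x) = x := by rw [← rmulMap_mul, inv_mul_cancel, rmulMap_one]

theorem rmulMap_eq_add (g : ↥(algGroup F R J)) (x : ↥J) : rmulMap g x = x + x * gElt g := by
  ext; simp [rmulMap, gElt, mul_sub]

theorem lmulMap_eq_add (g : ↥(algGroup F R J)) (x : ↥J) : lmulMap g x = x + gElt g * x := by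
  ext; simp [lmulMap, gElt, sub_mul]

variable (lam : ↥J →ₗ[F] F)

theorem rightAct_apply (s : ↥(algGroup F R J)) (x : ↥J) :
    rightAct s lam x = lam (rmulMap s⁻¹ x) := rfl

theorem coAct_apply (g : ↥(algGroup F R J)) (x : ↥J) :
    coAct g lam x = lam (lmulMap g (rmulMap g⁻¹ x)) := rfl

theorem gElt_conj (x g : ↥(algGroup F R J)) :
    gElt (x * g * x⁻¹) = lmulMap x (rmulMap x⁻¹ (gElt g)) := by
  ext
  have h : ((x : Rˣ) : R) * (((x⁻¹ : ↥(algGroup F R J)) : Rˣ) : R) = 1 := by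
    rw [← Units.val_mul, ← Subgroup.coe_mul, mul_inv_cancel]; rfl
  simp only [gElt, lmulMap, rmulMap, Subgroup.coe_mul, Units.val_mul, LinearMap.coe_mk,
    AddHom.coe_mk, sub_mul, one_mul, mul_sub]
  rw [h, mul_assoc]

theorem rightAct_rightAct (s t : ↥(algGroup F R J)) :
    rightAct t (rightAct s lam) = rightAct (s * t) lam := by
  ext x
  simp only [rightAct_apply, mul_inv_rev, rmulMap_mul]

theorem coAct_coAct (g h : ↥(algGroup F R J)) :
    coAct h (coAct g lam) = coAct (g * h) lam := by
  ext x
  simp only [coAct_apply, mul_inv_rev, rmulMap_mul, lmulMap_mul, lmulMap_rmulMap]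

@[simp] theorem rightAct_one : rightAct 1 lam = lam := by
  ext x; simp [rightAct_apply]

@[simp] theorem coAct_one : coAct 1 lam = lam := by
  ext x; simp [coAct_apply]

theorem rightAct_coAct (g s : ↥(algGroup F R J)) :
    rightAct s (coAct g lam) = coAct g (rightAct (g * s * g⁻¹) lam) := by
  ext x
  simp only [rightAct_apply, coAct_apply, mul_inv_rev, inv_inv, ← lmulMap_rmulMap, ← rmulMap_mul]
  congr 3
  group

theorem sChain_rightAct {s : ↥(algGroup F R J)} (hs : s ∈ Sbarg J lam) {i : ℕ}
    (hi : i ≤ Fintype.card R) : sChain J (rightAct s lam) i = sChain J lam i := by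
  have hE : ∀ x : R, x ∈ J → lamE J (rightAct s lam) x =
      lamE J lam (x * ((s⁻¹ : ↥(algGroup F R J)) : Rˣ)) := by
    intro x hx
    rw [lamE_apply J _ hx]
    exact (lamE_coe lam (rmulMap s⁻¹ ⟨x, hx⟩)).symm
  induction i with
  | zero => rfl
  | succ i ih =>
    have ih := ih (by omega)
    have hsi : ((s : ↥(algGroup F R J)) : Rˣ) ∈ algGroup F R (sChain J lam i) :=
      mem_algGroup_iff.mpr (sChain_antitone lam (by omega : i ≤ Fintype.card R)
        (mem_algSubgroup.mp hs))
    have hl : ∀ x, x ∈ lChain J lam i → ∀ u ∈ algGroup F R (sChain J lam i),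
        x * (u : R) ∈ lChain J lam i := by
      intro x hx u hu
      have : x * (u : R) = x * ((u : R) - 1) + x := by noncomm_ring
      rw [this]
      exact add_mem (lChain_mul_sChain lam hx hu.1) hx
    have hL : lChain J (rightAct s lam) i = lChain J lam i := by
      ext x
      rw [mem_lChain, mem_lChain, ih]
      refine and_congr_right fun hx => ⟨fun h y hy => ?_, fun h y hy => ?_⟩
      · have := h (y * (s : Rˣ)) (mul_mem_of_mem_algGroup hsi hy)
        rw [hE _ (mul_mem (sChain_le lam i hx)
          (sChain_le lam i (mul_mem_of_mem_algGroup hsi hy)))] at this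
        simpa [mul_assoc] using this
      · rw [hE _ (mul_mem (sChain_le lam i hx) (sChain_le lam i hy)), mul_assoc]
        exact h _ (mul_mem_of_mem_algGroup (inv_mem hsi) hy)
    ext x
    rw [mem_sChain_succ, mem_sChain_succ, ih, hL]
    refine and_congr_right fun hx => ⟨fun h y hy => ?_, fun h y hy => ?_⟩
    · have := h (y * (s : Rˣ)) (hl y hy _ hsi)
      rw [hE _ (mul_mem (sChain_le lam i hx)
        (sChain_le lam i (hl y hy _ hsi).1))] at this
      simpa [mul_assoc] using this
    · rw [hE _ (mul_mem (sChain_le lam i hx) (sChain_le lam i hy.1)), mul_assoc]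
      exact h _ (hl y hy _ (inv_mem hsi))

theorem Sbarg_rightAct {s : ↥(algGroup F R J)} (hs : s ∈ Sbarg J lam) :
    Sbarg J (rightAct s lam) = Sbarg J lam := by
  rw [Sbarg, Sbarg, sbar, sbar, sChain_rightAct lam hs le_rfl]

theorem coe_mem_sChain_coAct (g : ↥(algGroup F R J)) (i : ℕ) (x : ↥J) :
    (x : R) ∈ sChain J (coAct g lam) i ↔
      (lmulMap g (rmulMap g⁻¹ x) : R) ∈ sChain J lam i := by
  have hmul : ∀ x y : ↥J, lmulMap g (rmulMap g⁻¹ (x * y)) =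
      lmulMap g (rmulMap g⁻¹ x) * lmulMap g (rmulMap g⁻¹ y) := by
    intro x y; ext; simp [lmulMap, rmulMap, mul_assoc]
  have hE : ∀ x y : ↥J, lamE J (coAct g lam) ((x : R) * y) =
      lamE J lam ((lmulMap g (rmulMap g⁻¹ x) : R) * (lmulMap g (rmulMap g⁻¹ y) : R)) := by
    intro x y
    have h1 := lamE_coe (coAct g lam) (x * y)
    rw [coAct_apply, hmul, ← lamE_coe] at h1
    exact h1
  have hinv : ∀ y : ↥J, lmulMap g (rmulMap g⁻¹ (lmulMap g⁻¹ (rmulMap g y))) = y := by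
    intro y
    rw [lmulMap_rmulMap, ← lmulMap_mul, mul_inv_cancel, lmulMap_one, rmulMap_inv_rmulMap]
  induction i generalizing x with
  | zero => exact ⟨fun _ => Subtype.prop _, fun _ => Subtype.prop _⟩
  | succ i ih =>
    have hL : ∀ x : ↥J, (x : R) ∈ lChain J (coAct g lam) i ↔
        (lmulMap g (rmulMap g⁻¹ x) : R) ∈ lChain J lam i := by
      intro x
      rw [mem_lChain, mem_lChain]
      refine and_congr (ih x) ⟨fun h y hy => ?_, fun h y hy => ?_⟩
      · lift y to ↥J using sChain_le lam i hy
        rw [← hinv y] at hy ⊢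
        rw [← hE]
        exact h _ ((ih _).mpr hy)
      · lift y to ↥J using sChain_le _ i hy
        rw [hE]
        exact h _ ((ih _).mp hy)
    rw [mem_sChain_succ, mem_sChain_succ]
    refine and_congr (ih x) ⟨fun h y hy => ?_, fun h y hy => ?_⟩
    · lift y to ↥J using sChain_le lam i hy.1
      rw [← hinv y] at hy ⊢
      rw [← hE]
      exact h _ ((hL _).mpr hy)
    · lift y to ↥J using sChain_le _ i hy.1
      rw [hE]
      exact h _ ((hL _).mp hy)

theorem mem_Sbarg_coAct (g s : ↥(algGroup F R J)) :
    s ∈ Sbarg J (coAct g lam) ↔ g * s * g⁻¹ ∈ Sbarg J lam := by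
  rw [Sbarg, Sbarg, mem_algSubgroup, mem_algSubgroup, gElt_conj]
  exact coe_mem_sChain_coAct lam g _ _

theorem self_mem_Xi : lam ∈ Xi J lam := ⟨1, 1, one_mem _, by simp⟩

theorem Xi_rightAct {s : ↥(algGroup F R J)} (hs : s ∈ Sbarg J lam) :
    Xi J (rightAct s lam) = Xi J lam := by
  ext mu
  constructor
  · rintro ⟨g, t, ht, rfl⟩
    rw [Sbarg_rightAct lam hs] at ht
    exact ⟨g, s * t, mul_mem hs ht, by rw [rightAct_rightAct]⟩
  · rintro ⟨g, t, ht, rfl⟩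
    refine ⟨g, s⁻¹ * t, ?_, by rw [rightAct_rightAct, mul_inv_cancel_left]⟩
    rw [Sbarg_rightAct lam hs]
    exact mul_mem (inv_mem hs) ht

theorem Xi_coAct (g : ↥(algGroup F R J)) : Xi J (coAct g lam) = Xi J lam := by
  ext mu
  constructor
  · rintro ⟨h, t, ht, rfl⟩
    exact ⟨g * h, g * t * g⁻¹, (mem_Sbarg_coAct lam g t).mp ht, by
      rw [rightAct_coAct, coAct_coAct]⟩
  · rintro ⟨h, t, ht, rfl⟩
    have ht' : g * (g⁻¹ * t * g) * g⁻¹ = t := by group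
    refine ⟨g⁻¹ * h, g⁻¹ * t * g, ?_, ?_⟩
    · rw [mem_Sbarg_coAct, ht']; exact ht
    · rw [rightAct_coAct, coAct_coAct, mul_inv_cancel_left, ht']

theorem Xi_eq_of_mem {mu : ↥J →ₗ[F] F} (h : mu ∈ Xi J lam) : Xi J mu = Xi J lam := by
  obtain ⟨g, s, hs, rfl⟩ := h
  rw [Xi_coAct, Xi_rightAct lam hs]

theorem mem_Sbarg_of_coAct_eq {g s t : ↥(algGroup F R J)} (hs : s ∈ Sbarg J lam)
    (ht : t ∈ Sbarg J lam) (h : coAct g (rightAct s lam) = rightAct t lam) :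
    g ∈ Sbarg J lam := by
  have key : ∀ i ≤ Fintype.card R, g ∈ algSubgroup (sChain J lam i) J := by
    intro i
    induction i with
    | zero => exact fun _ => mem_algSubgroup.mpr (gElt g).2
    | succ i ih =>
      intro hi
      have hg := ih (by omega)
      have hle : sbar J lam ≤ sChain J lam i :=
        sChain_antitone lam (by omega : i ≤ Fintype.card R)
      have hs' := algSubgroup_mono hle hs
      have ht' := algSubgroup_mono hle ht
      have hfix : ∀ u ∈ algSubgroup (sChain J lam i) J, ∀ y : ↥J, (y : R) ∈ lChain J lam i →
          lam (rmulMap u y) = lam y := by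
        intro u hu y hy
        rw [rmulMap_eq_add, map_add, ← lamE_coe lam (y * gElt u)]
        exact (congrArg _ (hy.2 _ (mem_algSubgroup.mp hu))).trans (add_zero _)
      refine mem_algSubgroup.mpr ⟨mem_algSubgroup.mp hg, fun z hz => ?_⟩
      lift z to ↥J using sChain_le lam i hz.1
      have hy : (rmulMap s z : R) ∈ lChain J lam i := by
        rw [rmulMap_eq_add]
        exact add_mem hz (lChain_mul_sChain lam hz (mem_algSubgroup.mp hs'))
      have h1 := congrArg (fun f => f (rmulMap g (rmulMap s z))) h
      simp only [rightAct_apply, coAct_apply, rmulMap_inv_rmulMap, ← lmulMap_rmulMap] at h1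
      rw [← rmulMap_mul, ← rmulMap_mul, hfix _ (mul_mem hs' (mul_mem hg (inv_mem ht'))) z hz,
        lmulMap_eq_add, map_add, add_eq_left, ← lamE_coe] at h1
      exact h1
  exact key _ le_rfl

end Groups

section CharacterSums

variable {θ : AddChar F ℂ}

theorem sum_addChar_linearMap (hθ : θ ≠ 1) {W : Type*} [AddCommGroup W] [Module F W] [Fintype W]
    (f : W →ₗ[F] F) : ∑ w : W, θ (f w) = if f = 0 then (Fintype.card W : ℂ) else 0 := by
  split_ifs with hf
  · simp [hf]
  · obtain ⟨w, hw⟩ : ∃ w, f w ≠ 0 := by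
      by_contra! h
      exact hf (LinearMap.ext h)
    obtain ⟨a, ha⟩ := AddChar.ne_one_iff.mp hθ
    have := AddChar.sum_eq_zero_of_ne_one (R := W) (ψ := θ.compAddMonoidHom f.toAddMonoidHom) ?_
    · simpa using this
    · refine AddChar.ne_one_iff.mpr ⟨(a / f w) • w, ?_⟩
      simpa [div_mul_cancel₀ a hw] using ha

variable {J : NonUnitalSubalgebra F R} (lam : ↥J →ₗ[F] F)

theorem sum_Sbarg_rmulMap (hJ : IsNil J) (hθ : θ ≠ 1) (x : ↥J) :
    ∑ s : ↥(Sbarg J lam), θ (lam (rmulMap (s : ↥(algGroup F R J)) x)) =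
      if (x : R) ∈ lbar J lam then (Nat.card ↥(Sbarg J lam) : ℂ) * θ (lam x) else 0 := by
  let φ : ↥(sbar J lam) →ₗ[F] F :=
    { toFun := fun y => lam (x * ⟨y, sbar_le J lam y.2⟩)
      map_add' := fun y z => by
        rw [← map_add, ← mul_add]; rfl
      map_smul' := fun c y => by
        rw [RingHom.id_apply, ← map_smul, ← mul_smul_comm]; rfl }
  have h1 : ∑ s : ↥(Sbarg J lam), θ (lam (rmulMap (s : ↥(algGroup F R J)) x)) =
      ∑ y : ↥(sbar J lam), θ (lam x) * θ (φ y) := by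
    refine Fintype.sum_bijective _ (hJ.bijective_algSubgroup (sbar_le J lam)) _ _ fun s => ?_
    rw [rmulMap_eq_add, map_add, AddChar.map_add_eq_mul]
    rfl
  have hφ : φ = 0 ↔ (x : R) ∈ lbar J lam := by
    constructor
    · intro h
      refine mem_lbar_of_forall lam x.2 fun y hy => ?_
      have h2 := congrArg (fun f => f ⟨y, hy⟩) h
      exact (lamE_apply J lam _).trans h2
    · intro h
      ext y
      exact (lamE_apply J lam _).symm.trans (h.2 y y.2)
  rw [h1, ← Finset.mul_sum, sum_addChar_linearMap hθ, ← Nat.card_eq_fintype_card]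
  simp only [hφ, Sbarg, hJ.card_algSubgroup (sbar_le J lam)]
  split_ifs
  · rw [mul_comm]
  · rw [mul_zero]

theorem sum_rightAct (hJ : IsNil J) (hθ : θ ≠ 1) (x : ↥J) :
    ∑ s : ↥(Sbarg J lam), θ (rightAct (s : ↥(algGroup F R J)) lam x) =
      if (x : R) ∈ lbar J lam then (Nat.card ↥(Sbarg J lam) : ℂ) * θ (lam x) else 0 := by
  rw [← sum_Sbarg_rmulMap lam hJ hθ]
  exact Fintype.sum_equiv (Equiv.inv _) _ _ fun s => rfl

theorem thetaFn_mul {x y : ↥(algGroup F R J)} (hx : x ∈ Lbarg J lam) (hy : y ∈ Lbarg J lam) :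
    thetaFn θ J lam (x * y) = thetaFn θ J lam x * thetaFn θ J lam y := by
  have h : gElt (x * y) = gElt x * gElt y + gElt x + gElt y := by
    ext
    simp only [gElt, Subgroup.coe_mul, Units.val_mul, NonUnitalSubalgebra.coe_add,
      NonUnitalSubalgebra.coe_mul]
    noncomm_ring
  have h0 : lam (gElt x * gElt y) = 0 := (lamE_coe lam _).symm.trans
    ((mem_algSubgroup.mp hx).2 _ (mem_algSubgroup.mp hy).1)
  simp only [thetaFn, h, map_add, h0, zero_add, AddChar.map_add_eq_mul]

/-- The linear character `θ_λ` of `L̄_λ`. -/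
def thetaHom (θ : AddChar F ℂ) (J : NonUnitalSubalgebra F R) (lam : ↥J →ₗ[F] F) :
    ↥(Lbarg J lam) →* ℂ where
  toFun x := thetaFn θ J lam x
  map_one' := by
    have : gElt (1 : ↥(algGroup F R J)) = 0 := by ext; simp [gElt]
    simp [thetaFn, this]
  map_mul' x y := thetaFn_mul lam x.2 y.2

theorem xi_eq_indFun : xi θ J lam = indFun (Lbarg J lam) (thetaHom θ J lam) := rfl

theorem card_mul_xi (hJ : IsNil J) (hθ : θ ≠ 1) (g : ↥(algGroup F R J)) :
    (Nat.card ↥(Sbarg J lam) : ℂ) * Nat.card ↥(Lbarg J lam) * xi θ J lam g =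
      ∑ x : ↥(algGroup F R J), ∑ s : ↥(Sbarg J lam),
        thetaFn θ J (coAct x (rightAct (s : ↥(algGroup F R J)) lam)) g := by
  have hc : (Nat.card ↥(Lbarg J lam) : ℂ) ≠ 0 := Nat.cast_ne_zero.mpr Nat.card_pos.ne'
  rw [xi_eq_indFun, indFun_eq_sum, ← mul_assoc, mul_assoc _ _ (_⁻¹), mul_inv_cancel₀ hc, mul_one,
    Finset.mul_sum]
  refine Finset.sum_congr rfl fun x _ => ?_
  simp only [thetaFn, coAct_apply (rightAct _ lam), sum_rightAct lam hJ hθ, ← gElt_conj]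
  by_cases h : x * g * x⁻¹ ∈ Lbarg J lam
  · rw [dif_pos h, if_pos (mem_algSubgroup.mp h)]
    rfl
  · rw [dif_neg h, if_neg (mt mem_algSubgroup.mpr h), mul_zero]

theorem card_mul_card_eq_zero (hθ : θ ≠ 1) {ι : Type*} [Fintype ι] (φ : ι → (↥J →ₗ[F] F)) :
    (Nat.card ↥J : ℂ) * Fintype.card {i // φ i = 0} = ∑ x : ↥J, ∑ i, θ (φ i x) := by
  rw [Finset.sum_comm]
  simp only [sum_addChar_linearMap hθ]
  rw [← Finset.sum_filter, Finset.sum_const, Fintype.card_subtype, nsmul_eq_mul, mul_comm,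
    Nat.card_eq_fintype_card]

theorem card_pairs (hJ : IsNil J) (hθ : θ ≠ 1) :
    (Nat.card ↥J : ℂ) * Fintype.card {q : ↥(Sbarg J lam) × ↥(Sbarg J lam) //
      lam ∘ₗ lmulMap (q.1 : ↥(algGroup F R J)) - lam ∘ₗ rmulMap (q.2 : ↥(algGroup F R J)) = 0} =
    (Nat.card ↥(Sbarg J lam) : ℂ) ^ 2 * Nat.card ↥(Lbarg J lam) := by
  rw [card_mul_card_eq_zero hθ]
  have h1 : ∀ x : ↥J, ∑ q : ↥(Sbarg J lam) × ↥(Sbarg J lam),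
      θ ((lam ∘ₗ lmulMap (q.1 : ↥(algGroup F R J)) -
        lam ∘ₗ rmulMap (q.2 : ↥(algGroup F R J))) x) =
      if (x : R) ∈ lbar J lam then (Nat.card ↥(Sbarg J lam) : ℂ) ^ 2 else 0 := by
    intro x
    have h2 : ∀ a b : ↥(algGroup F R J), θ ((lam ∘ₗ lmulMap a - lam ∘ₗ rmulMap b) x) =
        θ (lam (lmulMap a x)) * θ (lam (rmulMap b (-x))) := by
      intro a b
      rw [← AddChar.map_add_eq_mul, map_neg, map_neg, ← sub_eq_add_neg]
      rfl
    rw [Fintype.sum_prod_type]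
    simp only [h2, ← Finset.mul_sum, sum_Sbarg_rmulMap lam hJ hθ, NonUnitalSubalgebra.coe_neg,
      neg_mem_iff]
    split_ifs with hx
    · have h3 : ∀ a : ↥(Sbarg J lam), lam (lmulMap (a : ↥(algGroup F R J)) x) = lam x := by
        intro a
        rw [lmulMap_eq_add, map_add, ← lamE_coe lam (_ * x), add_eq_left]
        exact lamE_mul_eq_zero lam (mem_algSubgroup.mp a.2) hx
      simp only [h3]
      rw [Finset.sum_const, Finset.card_univ, ← Nat.card_eq_fintype_card, nsmul_eq_mul,
        mul_left_comm (θ (lam x)), ← AddChar.map_add_eq_mul, ← map_add, add_neg_cancel, map_zero,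
        AddChar.map_zero_eq_one]
      ring
    · simp
  simp only [h1]
  rw [← Finset.sum_filter, Finset.sum_const, nsmul_eq_mul, mul_comm]
  congr 2
  rw [Lbarg, hJ.card_algSubgroup (lbar_le J lam), ← Fintype.card_subtype,
    ← Nat.card_eq_fintype_card]
  refine Nat.card_congr ⟨fun x => ⟨x.1, x.2⟩, fun x => ⟨⟨x, lbar_le J lam x.2⟩, x.2⟩,
    fun _ => rfl, fun _ => rfl⟩

theorem card_fiber (hJ : IsNil J) (hθ : θ ≠ 1) {mu : ↥J →ₗ[F] F} (hmu : mu ∈ Xi J lam) :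
    (Nat.card ↥J : ℂ) * Fintype.card {p : ↥(algGroup F R J) × ↥(Sbarg J lam) //
      coAct p.1 (rightAct (p.2 : ↥(algGroup F R J)) lam) = mu} =
    (Nat.card ↥(Sbarg J lam) : ℂ) ^ 2 * Nat.card ↥(Lbarg J lam) := by
  obtain ⟨h, t, ht, rfl⟩ := hmu
  rw [← card_pairs lam hJ hθ]
  congr 2
  have key : ∀ (g : ↥(algGroup F R J)) (s : ↥(algGroup F R J)),
      coAct (g * h) (rightAct s lam) = coAct h (rightAct t lam) ↔
        lam ∘ₗ lmulMap g - lam ∘ₗ rmulMap (s * g * t⁻¹) = 0 := by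
    intro g s
    rw [sub_eq_zero]
    constructor
    · intro hgs
      have hgs' : coAct g (rightAct s lam) = rightAct t lam := by
        have := congrArg (coAct h⁻¹) hgs
        simpa only [coAct_coAct, mul_assoc, mul_inv_cancel, mul_one, coAct_one] using this
      ext x
      have h1 := congrArg (fun f => f (rmulMap g (rmulMap s x))) hgs'
      simp only [rightAct_apply, coAct_apply, rmulMap_inv_rmulMap, ← lmulMap_rmulMap] at h1
      simpa only [LinearMap.comp_apply, rmulMap_mul] using h1
    · intro hgs
      rw [← coAct_coAct]
      congr 1
      ext x
      have h1 := congrArg (fun f => f (rmulMap s⁻¹ (rmulMap g⁻¹ x))) hgs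
      simp only [LinearMap.comp_apply, rmulMap_mul, rmulMap_rmulMap_inv] at h1
      simpa only [rightAct_apply, coAct_apply, ← lmulMap_rmulMap] using h1
  symm
  refine Fintype.card_of_bijective (f := fun q => ⟨((q.1.1 : ↥(algGroup F R J)) * h,
    q.1.2 * ⟨t, ht⟩ * q.1.1⁻¹), (key _ _).mpr ?_⟩) ⟨?_, ?_⟩
  · refine Eq.trans ?_ q.2
    simp
  · rintro ⟨⟨a, b⟩, hab⟩ ⟨⟨a', b'⟩, hab'⟩ heq
    simp only [Subtype.mk.injEq, Prod.mk.injEq, mul_left_inj, Subtype.coe_inj] at heq ⊢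
    obtain ⟨rfl, h2⟩ := heq
    exact ⟨rfl, by simpa using h2⟩
  · rintro ⟨⟨g, s⟩, hgs⟩
    have hgs' : coAct (g * h⁻¹ * h) (rightAct (s : ↥(algGroup F R J)) lam) =
        coAct h (rightAct t lam) := by
      rw [inv_mul_cancel_right]; exact hgs
    have hmem : g * h⁻¹ ∈ Sbarg J lam := by
      refine mem_Sbarg_of_coAct_eq lam s.2 ht ?_
      have := congrArg (coAct h⁻¹) hgs'
      simpa only [coAct_coAct, mul_assoc, mul_inv_cancel, mul_one, coAct_one] using this
    refine ⟨⟨(⟨g * h⁻¹, hmem⟩, s * ⟨g * h⁻¹, hmem⟩ * ⟨t, ht⟩⁻¹),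
      (key (g * h⁻¹) s).mp hgs'⟩, Subtype.ext (Prod.ext ?_ ?_)⟩
    · exact inv_mul_cancel_right g h
    · change s * ⟨g * h⁻¹, hmem⟩ * ⟨t, ht⟩⁻¹ * ⟨t, ht⟩ * ⟨g * h⁻¹, hmem⟩⁻¹ = s
      rw [inv_mul_cancel_right, mul_inv_cancel_right]

instance : Finite (↥J →ₗ[F] F) := Finite.of_injective _ DFunLike.coe_injective

theorem card_mul_xi_eq_sum (hJ : IsNil J) (hθ : θ ≠ 1) (g : ↥(algGroup F R J)) :
    (Nat.card ↥(algGroup F R J) : ℂ) * xi θ J lam g =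
      Nat.card ↥(Sbarg J lam) * ∑ᶠ mu ∈ Xi J lam, thetaFn θ J mu g := by
  have := Fintype.ofFinite (↥J →ₗ[F] F)
  have hS : (Nat.card ↥(Sbarg J lam) : ℂ) ≠ 0 := Nat.cast_ne_zero.mpr Nat.card_pos.ne'
  have hL : (Nat.card ↥(Lbarg J lam) : ℂ) ≠ 0 := Nat.cast_ne_zero.mpr Nat.card_pos.ne'
  have hmem : ∀ p : ↥(algGroup F R J) × ↥(Sbarg J lam),
      coAct p.1 (rightAct (p.2 : ↥(algGroup F R J)) lam) ∈ (Xi J lam).toFinset := fun p =>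
    Set.mem_toFinset.mpr ⟨p.1, p.2, p.2.2, rfl⟩
  have h1 := card_mul_xi lam hJ hθ g
  rw [← Fintype.sum_prod_type'
    (f := fun x (s : ↥(Sbarg J lam)) => thetaFn θ J (coAct x (rightAct s lam)) g),
    ← Finset.sum_fiberwise_of_maps_to (t := (Xi J lam).toFinset) fun p _ => hmem p] at h1
  have h2 : (Nat.card ↥J : ℂ) *
      ((Nat.card ↥(Sbarg J lam) : ℂ) * Nat.card ↥(Lbarg J lam) * xi θ J lam g) =
      (Nat.card ↥(Sbarg J lam) : ℂ) ^ 2 * Nat.card ↥(Lbarg J lam) *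
        ∑ mu ∈ (Xi J lam).toFinset, thetaFn θ J mu g := by
    rw [h1, Finset.mul_sum, Finset.mul_sum]
    refine Finset.sum_congr rfl fun mu hmu => ?_
    rw [← card_fiber lam hJ hθ (Set.mem_toFinset.mp hmu), Fintype.card_subtype,
      Finset.sum_congr rfl fun p hp => by rw [(Finset.mem_filter.mp hp).2],
      Finset.sum_const, nsmul_eq_mul, mul_assoc]
  rw [finsum_mem_eq_toFinset_sum, hJ.card_algGroup]
  refine mul_left_cancel₀ (mul_ne_zero hS hL) ?_
  linear_combination h2

theorem Xi_inter_nonempty (hJ : IsNil J) (hθ : θ ≠ 1) (lam' : ↥J →ₗ[F] F) (g : ↥(algGroup F R J))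
    (hg : ∀ (x : ↥(Lbarg J lam)) (y : ↥(Lbarg J lam')), (x : ↥(algGroup F R J)) * g = g * y →
      thetaHom θ J lam x = thetaHom θ J lam' y) : (Xi J lam ∩ Xi J lam').Nonempty := by
  have hS : (Nat.card ↥(Sbarg J lam) : ℂ) ≠ 0 := Nat.cast_ne_zero.mpr Nat.card_pos.ne'
  have hS' : (Nat.card ↥(Sbarg J lam') : ℂ) ≠ 0 := Nat.cast_ne_zero.mpr Nat.card_pos.ne'
  have hcount := card_mul_card_eq_zero hθ
    (fun p : ↥(Sbarg J lam) × ↥(Sbarg J lam') =>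
      coAct g (rightAct (p.1 : ↥(algGroup F R J)) lam) -
        rightAct (p.2 : ↥(algGroup F R J)) lam')
  let P : ↥J → Prop := fun x =>
    (lmulMap g (rmulMap g⁻¹ x) : R) ∈ lbar J lam ∧ (x : R) ∈ lbar J lam'
  have h1 : ∀ x : ↥J, ∑ p : ↥(Sbarg J lam) × ↥(Sbarg J lam'),
      θ ((coAct g (rightAct (p.1 : ↥(algGroup F R J)) lam) -
        rightAct (p.2 : ↥(algGroup F R J)) lam') x) =
      if P x then (Nat.card ↥(Sbarg J lam) : ℂ) * Nat.card ↥(Sbarg J lam') else 0 := by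
    intro x
    have h2 : ∀ a b : ↥J →ₗ[F] F, θ ((a - b) x) = θ (a x) * θ (b (-x)) := by
      intro a b
      rw [← AddChar.map_add_eq_mul, map_neg, ← sub_eq_add_neg]
      rfl
    rw [Fintype.sum_prod_type]
    simp only [h2, ← Finset.mul_sum, ← Finset.sum_mul, coAct_apply (rightAct _ lam),
      sum_rightAct _ hJ hθ, NonUnitalSubalgebra.coe_neg, neg_mem_iff]
    by_cases hx : (lmulMap g (rmulMap g⁻¹ x) : R) ∈ lbar J lam
    · by_cases hx' : (x : R) ∈ lbar J lam'
      · obtain ⟨y, rfl⟩ := hJ.gElt_surjective x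
        rw [if_pos hx, if_pos hx', if_pos ⟨hx, hx'⟩]
        have h3 : θ (lam (lmulMap g (rmulMap g⁻¹ (gElt y)))) = θ (lam' (gElt y)) := by
          rw [← gElt_conj] at hx ⊢
          exact hg ⟨_, mem_algSubgroup.mpr hx⟩ ⟨y, mem_algSubgroup.mpr hx'⟩
            (inv_mul_cancel_right _ _)
        rw [h3, mul_mul_mul_comm, ← AddChar.map_add_eq_mul, ← map_add, add_neg_cancel, map_zero,
          AddChar.map_zero_eq_one, mul_one]
      · rw [if_neg hx', if_neg (c := P x) fun h => hx' h.2, mul_zero]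
    · rw [if_neg hx, if_neg (c := P x) fun h => hx h.1, zero_mul]
  have hpos : 0 < (Finset.univ.filter P).card := Finset.card_pos.mpr ⟨0, by simp [P]⟩
  simp only [h1] at hcount
  rw [← Finset.sum_filter, Finset.sum_const, nsmul_eq_mul] at hcount
  have hne : Fintype.card {p : ↥(Sbarg J lam) × ↥(Sbarg J lam') //
      coAct g (rightAct (p.1 : ↥(algGroup F R J)) lam) -
        rightAct (p.2 : ↥(algGroup F R J)) lam' = 0} ≠ 0 := by
    intro h0
    rw [h0, Nat.cast_zero, mul_zero] at hcount
    exact mul_ne_zero (Nat.cast_ne_zero.mpr hpos.ne') (mul_ne_zero hS hS') hcount.symm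
  obtain ⟨⟨⟨s, t⟩, hst⟩⟩ := Fintype.card_pos_iff.mp (Nat.pos_of_ne_zero hne)
  exact ⟨_, ⟨g, s, s.2, rfl⟩, ⟨1, t, t.2, by rw [coAct_one]; exact sub_eq_zero.mp hst⟩⟩

theorem sum_thetaFn (hJ : IsNil J) (hθ : θ ≠ 1) (g : ↥(algGroup F R J)) :
    ∑ᶠ mu : ↥J →ₗ[F] F, thetaFn θ J mu g =
      if g = 1 then (Nat.card ↥(algGroup F R J) : ℂ) else 0 := by
  have := Fintype.ofFinite (↥J →ₗ[F] F)
  have hg1 : gElt g = 0 ↔ g = 1 := by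
    have : gElt (1 : ↥(algGroup F R J)) = 0 := by ext; simp [gElt]
    rw [← this, gElt_injective.eq_iff]
  have hev : LinearMap.applyₗ (R := F) (M₂ := F) (gElt g) = 0 ↔ gElt g = 0 := by
    rw [← Module.forall_dual_apply_eq_zero_iff F (gElt g), LinearMap.ext_iff]
    rfl
  have h := sum_addChar_linearMap hθ (LinearMap.applyₗ (R := F) (M₂ := F) (gElt g))
  rw [finsum_eq_sum_of_fintype]
  simp only [hev, hg1] at h
  refine h.trans ?_
  rw [hJ.card_algGroup, ← Nat.card_eq_fintype_card]
  congr 2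
  exact Nat.card_congr (Module.finBasis F ↥J).toDualEquiv.symm.toEquiv

theorem card_div_mul_xi (hJ : IsNil J) (hθ : θ ≠ 1) (g : ↥(algGroup F R J)) :
    (Nat.card ↥(algGroup F R J) : ℂ) / Nat.card ↥(Sbarg J lam) * xi θ J lam g =
      ∑ᶠ mu ∈ Xi J lam, thetaFn θ J mu g := by
  have hS : (Nat.card ↥(Sbarg J lam) : ℂ) ≠ 0 := Nat.cast_ne_zero.mpr Nat.card_pos.ne'
  rw [div_mul_eq_mul_div, card_mul_xi_eq_sum lam hJ hθ, mul_div_cancel_left₀ _ hS]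

theorem innerG_xi_pos {f : ↥(algGroup F R J) → ℂ} (hf : IsCharacter ↥(algGroup F R J) f)
    (h : innerG ↥(algGroup F R J) (xi θ J lam) f ≠ 0) :
    0 < innerG ↥(algGroup F R J) (xi θ J lam) f := by
  rw [xi_eq_indFun] at h ⊢
  exact innerG_indFun_pos (Lbarg J lam) (thetaHom θ J lam) f hf h

theorem compat_of_mem_irrConstituents_xi (lam' : ↥J →ₗ[F] F) {f : ↥(algGroup F R J) → ℂ}
    (hf : f ∈ IrrConstituents ↥(algGroup F R J) (xi θ J lam))
    (hf' : f ∈ IrrConstituents ↥(algGroup F R J) (xi θ J lam')) :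
    ∃ g : ↥(algGroup F R J), ∀ (x : ↥(Lbarg J lam)) (y : ↥(Lbarg J lam')),
      (x : ↥(algGroup F R J)) * g = g * y → thetaHom θ J lam x = thetaHom θ J lam' y := by
  rw [xi_eq_indFun] at hf hf'
  exact compat_of_mem_irrConstituents (Lbarg J lam) (Lbarg J lam') (thetaHom θ J lam)
    (thetaHom θ J lam') f hf hf'

theorem irrConstituents_xi_subset (hJ : IsNil J) (hθ : θ ≠ 1) {lam' : ↥J →ₗ[F] F}
    (h : Xi J lam = Xi J lam') : IrrConstituents ↥(algGroup F R J) (xi θ J lam) ⊆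
      IrrConstituents ↥(algGroup F R J) (xi θ J lam') := by
  rintro f ⟨hf, hpos⟩
  refine ⟨hf, innerG_xi_pos lam' hf.1 fun h0 => hpos.ne' ?_⟩
  have hS : (Nat.card ↥(Sbarg J lam) : ℂ) ≠ 0 := Nat.cast_ne_zero.mpr Nat.card_pos.ne'
  have hS' : (Nat.card ↥(Sbarg J lam') : ℂ) ≠ 0 := Nat.cast_ne_zero.mpr Nat.card_pos.ne'
  rw [innerG_eq_sum] at h0
  have h2 : ∀ g, xi θ J lam g = (Nat.card ↥(Sbarg J lam) : ℂ) / Nat.card ↥(Sbarg J lam') *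
      xi θ J lam' g := by
    intro g
    have h3 := card_div_mul_xi lam hJ hθ g
    rw [h, ← card_div_mul_xi lam' hJ hθ] at h3
    field_simp at h3 ⊢
    linear_combination h3
  rw [innerG_eq_sum]
  simp only [h2, mul_assoc, ← Finset.mul_sum]
  rw [mul_left_comm, h0, mul_zero]

theorem eq_of_mem_Xi_of_mem_Xi {lam lam' mu : ↥J →ₗ[F] F} (h : mu ∈ Xi J lam)
    (h' : mu ∈ Xi J lam') : Xi J lam = Xi J lam' :=
  (Xi_eq_of_mem lam h).symm.trans (Xi_eq_of_mem lam' h')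

theorem finite_of_disjoint_Xi {I : Type} {ν : I → (↥J →ₗ[F] F)}
    (hdisj : ∀ i j, i ≠ j → Disjoint (Xi J (ν i)) (Xi J (ν j))) : Finite I := by
  refine Finite.of_injective ν fun i j hij => ?_
  by_contra hne
  exact Set.disjoint_left.mp (hdisj i j hne) (self_mem_Xi _) (hij ▸ self_mem_Xi _)

theorem regular_eq_sum_xi (hJ : IsNil J) (hθ : θ ≠ 1) {I : Type} {ν : I → (↥J →ₗ[F] F)}
    (hcover : (⋃ i, Xi J (ν i)) = Set.univ)
    (hdisj : ∀ i j, i ≠ j → Disjoint (Xi J (ν i)) (Xi J (ν j))) (g : ↥(algGroup F R J)) :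
    (if g = 1 then (Nat.card ↥(algGroup F R J) : ℂ) else 0) =
      ∑ᶠ i, ((Nat.card ↥(algGroup F R J) : ℂ) / (Nat.card ↥(Sbarg J (ν i)) : ℂ)) *
        xi θ J (ν i) g := by
  have := finite_of_disjoint_Xi hdisj
  simp only [card_div_mul_xi _ hJ hθ]
  rw [← finsum_mem_iUnion (fun i j hij => hdisj i j hij) fun _ => Set.toFinite _, hcover,
    finsum_mem_univ, sum_thetaFn hJ hθ]

theorem exists_mem_irrConstituents_xi (hJ : IsNil J) (hθ : θ ≠ 1) {f : ↥(algGroup F R J) → ℂ}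
    (hf : f ∈ Irr ↥(algGroup F R J)) :
    ∃ lam : ↥J →ₗ[F] F, f ∈ IrrConstituents ↥(algGroup F R J) (xi θ J lam) := by
  have hreg := regular_eq_sum_xi hJ hθ (I := Set.range (Xi J)) (ν := fun i => i.2.choose)
    (Set.eq_univ_of_forall fun mu => Set.mem_iUnion.mpr ⟨⟨Xi J mu, mu, rfl⟩, by
      have h := (⟨mu, rfl⟩ : Xi J mu ∈ Set.range (Xi J)).choose_spec
      rw [h]; exact self_mem_Xi mu⟩)
    (fun i j hij => Set.disjoint_left.mpr fun mu hi hj => hij (Subtype.ext (by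
      rw [← i.2.choose_spec, ← j.2.choose_spec]
      exact eq_of_mem_Xi_of_mem_Xi hi hj)))
  have := Fintype.ofFinite (Set.range (Xi J))
  simp only [finsum_eq_sum_of_fintype] at hreg
  by_contra! hcon
  have hzero : ∀ lam : ↥J →ₗ[F] F,
      ∑ g, xi θ J lam g * (starRingEnd ℂ) (f g) = 0 := by
    intro lam
    by_contra h0
    refine hcon lam ⟨hf, innerG_xi_pos lam hf.1 ?_⟩
    rw [innerG_eq_sum]
    exact mul_ne_zero (inv_ne_zero (Nat.cast_ne_zero.mpr Nat.card_pos.ne')) h0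
  have h1 : ∑ g : ↥(algGroup F R J), (if g = 1 then (Nat.card ↥(algGroup F R J) : ℂ) else 0) *
      (starRingEnd ℂ) (f g) = 0 := by
    simp only [hreg, Finset.sum_mul]
    rw [Finset.sum_comm]
    simp only [mul_assoc, ← Finset.mul_sum, hzero, mul_zero, Finset.sum_const_zero]
  simp only [ite_mul, zero_mul, Finset.sum_ite_eq', Finset.mem_univ, if_true] at h1
  refine mul_ne_zero (Nat.cast_ne_zero.mpr Nat.card_pos.ne') ?_ h1
  exact (map_ne_zero _).mpr (Irr.apply_one_ne_zero hf)

end CharacterSums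

theorem statement12 (F : Type) [Field F] [Fintype F]
    (R : Type) [Ring R] [Algebra F R] [Fintype R]
    (J : NonUnitalSubalgebra F R) (hJ : IsNil J)
    (θ : AddChar F ℂ) (hθ : θ ≠ 1) :
    (∀ lam : ↥J →ₗ[F] F, lam ∈ Xi J lam) ∧
    (∀ lam lam' : ↥J →ₗ[F] F, (Xi J lam ∩ Xi J lam').Nonempty → Xi J lam = Xi J lam') ∧
    (∀ f ∈ Irr ↥(algGroup F R J), ∃ lam : ↥J →ₗ[F] F,
      f ∈ IrrConstituents ↥(algGroup F R J) (xi θ J lam)) ∧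
    (∀ lam lam' : ↥J →ₗ[F] F,
      IrrConstituents ↥(algGroup F R J) (xi θ J lam) =
        IrrConstituents ↥(algGroup F R J) (xi θ J lam') ∨
      IrrConstituents ↥(algGroup F R J) (xi θ J lam) ∩
        IrrConstituents ↥(algGroup F R J) (xi θ J lam') = ∅) ∧
    (∀ (I : Type) (ν : I → (↥J →ₗ[F] F)),
      (⋃ i, Xi J (ν i)) = Set.univ →
      (∀ i j, i ≠ j → Disjoint (Xi J (ν i)) (Xi J (ν j))) →
      ∀ g : ↥(algGroup F R J),
        (if g = 1 then (Nat.card ↥(algGroup F R J) : ℂ) else 0) =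
          ∑ᶠ i, ((Nat.card ↥(algGroup F R J) : ℂ) / (Nat.card ↥(Sbarg J (ν i)) : ℂ)) *
            xi θ J (ν i) g) := by
  refine ⟨self_mem_Xi, fun lam lam' ⟨mu, h, h'⟩ => eq_of_mem_Xi_of_mem_Xi h h',
    fun f hf => exists_mem_irrConstituents_xi hJ hθ hf, fun lam lam' => ?_,
    fun I ν hcover hdisj g => regular_eq_sum_xi hJ hθ hcover hdisj g⟩
  refine or_iff_not_imp_right.mpr fun hne => ?_
  obtain ⟨f, hf, hf'⟩ := Set.nonempty_iff_ne_empty.mpr hne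
  obtain ⟨g, hg⟩ := compat_of_mem_irrConstituents_xi lam lam' hf hf'
  obtain ⟨mu, h, h'⟩ := Xi_inter_nonempty lam hJ hθ lam' g hg
  have hXi := eq_of_mem_Xi_of_mem_Xi h h'
  exact (irrConstituents_xi_subset lam hJ hθ hXi).antisymm
    (irrConstituents_xi_subset lam' hJ hθ hXi.symm)

end IterChar
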